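/- Let I ⊆ K[x_1,…,x_n] be a graded ideal in the polynomial ring over a field K. Then there exist integers a and b such that the Castelnuovo-Mumford regularity satisfies reg(I^k) ≤ a·k + b for all k ≥ 1. -/

import Mathlib

open Submodule MvPolynomial

section

variable {K : Type*} [Field K] (n : ℕ)

/-- The homogeneous elements of degree `t` of the graded free module
`F = ⊕_r R(-deg r)` over `R = K[x_1, …, x_n]` (all generator degrees in `ℕ`). -/
noncomputable def freeHomPiece {s : ℕ} (deg : Fin s → ℕ) (t : ℕ) :
    Submodule K (Fin s → MvPolynomial (Fin n) K) :=
  Submodule.pi Set.univ fun r =>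
    if deg r ≤ t then homogeneousSubmodule (Fin n) K (t - deg r) else ⊥

/-- The graded (irrelevant) maximal ideal `m = (x_1, …, x_n)` of `K[x_1, …, x_n]`. -/
noncomputable def polyMaxIdeal (K : Type*) [Field K] (n : ℕ) :
    Ideal (MvPolynomial (Fin n) K) :=
  Ideal.span (Set.range MvPolynomial.X)

variable (M : Type*) [AddCommGroup M] [Module (MvPolynomial (Fin n) K) M] [Module K M]
  (ℳ : ℕ → Submodule K M)

/-- A minimal graded free resolution `… → F_1 → F_0 → M → 0` of a (nonnegatively) graded
module `M` over the polynomial ring `R = K[x_1, …, x_n]`, with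
`F_j = ⊕_{r < β j} R(-deg j r)`: the augmentation and the differentials are graded
(degree-preserving), the complex is exact, and all differentials have image contained in
`m F_j`, where `m = (x_1, …, x_n)`.  The graded Betti number `β_{j,t}(M)` is the number
of indices `r : Fin (β j)` with `deg j r = t`. -/
structure GradedMinFreeRes where
  β : ℕ → ℕ
  deg : ∀ j : ℕ, Fin (β j) → ℕ
  aug : (Fin (β 0) → MvPolynomial (Fin n) K) →ₗ[MvPolynomial (Fin n) K] M
  d : ∀ j : ℕ, (Fin (β (j + 1)) → MvPolynomial (Fin n) K)
        →ₗ[MvPolynomial (Fin n) K] (Fin (β j) → MvPolynomial (Fin n) K)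
  aug_surj : Function.Surjective aug
  exact_aug : LinearMap.ker aug = LinearMap.range (d 0)
  exact : ∀ j : ℕ, LinearMap.ker (d j) = LinearMap.range (d (j + 1))
  minimal : ∀ j : ℕ, LinearMap.range (d j) ≤
    polyMaxIdeal K n •
      (⊤ : Submodule (MvPolynomial (Fin n) K) (Fin (β j) → MvPolynomial (Fin n) K))
  aug_graded : ∀ (t : ℕ) (x : Fin (β 0) → MvPolynomial (Fin n) K),
    x ∈ freeHomPiece n (deg 0) t → aug x ∈ ℳ t
  d_graded : ∀ (j : ℕ) (t : ℕ) (x : Fin (β (j + 1)) → MvPolynomial (Fin n) K),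
    x ∈ freeHomPiece n (deg (j + 1)) t → d j x ∈ freeHomPiece n (deg j) t

end

open scoped Matrix.Module

/-- `A` is (the total differential of) a Koszul complex on the variables `X i`, `i ∈ s`, with
homological degrees `wt` and degree zero basis element `o`. -/
structure IsKoszulMatrix {K : Type*} [Field K] {n : ℕ} {ι : Type*} [Fintype ι] [DecidableEq ι]
    (s : Set (Fin n)) (A : Matrix ι ι (MvPolynomial (Fin n) K)) (wt : ι → ℕ) (o : ι) : Prop where
  sq : A * A = 0
  homotopy : ∀ i ∈ s, ∃ H : Matrix ι ι (MvPolynomial (Fin n) K),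
    A * H + H * A = Matrix.scalar ι (X i)
  isHomogeneous : ∀ a b, (A a b).IsHomogeneous 1
  wt_eq : ∀ a b, A a b ≠ 0 → wt b = wt a + 1
  wt_zero : wt o = 0
  col_zero : ∀ a, A a o = 0
  row_mem : ∀ b, A o b ∈ Ideal.span (X '' s : Set (MvPolynomial (Fin n) K))
  exact : ∀ v : ι → MvPolynomial (Fin n) K, A • v = 0 →
    v o ∈ Ideal.span (X '' s : Set (MvPolynomial (Fin n) K)) → ∃ w, A • w = v

theorem matrix_smul_comm {R S M ι : Type*} [CommRing R] [AddCommGroup M] [Module R M] [Fintype ι]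
    [DecidableEq ι] [Monoid S] [DistribMulAction S M] [SMulCommClass R S M] (A : Matrix ι ι R)
    (r : S) (v : ι → M) : A • (r • v) = r • (A • v) := by
  ext a
  simp only [Matrix.Module.smul_apply, Pi.smul_apply, Finset.smul_sum]
  exact Finset.sum_congr rfl fun b _ => smul_comm _ _ _

theorem matrix_smul_map {R M N ι : Type*} [CommRing R] [AddCommGroup M] [Module R M]
    [AddCommGroup N] [Module R N] [Fintype ι] [DecidableEq ι] (f : M →ₗ[R] N)
    (A : Matrix ι ι R) (v : ι → M) : (fun a => f ((A • v) a)) = A • (fun a => f (v a)) := by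
  ext a
  simp

theorem matrix_smul_pi_apply {R κ ι : Type*} [CommRing R] [Fintype ι] [DecidableEq ι]
    (A : Matrix ι ι R) (v : ι → κ → R) (a : ι) (r : κ) :
    (A • v) a r = (A • fun b => v b r) a := by
  simp [Finset.sum_apply]

theorem matrix_smul_mem {R M ι : Type*} [CommRing R] [AddCommGroup M] [Module R M]
    [Fintype ι] [DecidableEq ι] (N : Submodule R M) (A : Matrix ι ι R) {v : ι → M}
    (hv : ∀ a, v a ∈ N) (a : ι) : (A • v) a ∈ N :=
  N.sum_mem fun b _ => N.smul_mem _ (hv b)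

theorem mem_span_X_of_X_mul_mem {K : Type*} [Field K] {n : ℕ} {s : Set (Fin n)} {i : Fin n}
    (hi : i ∉ s) {f : MvPolynomial (Fin n) K}
    (hf : X i * f ∈ Ideal.span (X '' s : Set (MvPolynomial (Fin n) K))) :
    f ∈ Ideal.span (X '' s : Set (MvPolynomial (Fin n) K)) := by
  rw [mem_ideal_span_X_image] at hf ⊢
  intro m hm
  obtain ⟨j, hj, hj'⟩ := hf (Finsupp.single i 1 + m) (by
    rw [mem_support_iff, coeff_X_mul]
    exact mem_support_iff.mp hm)
  refine ⟨j, hj, ?_⟩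
  have : i ≠ j := fun h => hi (h ▸ hj)
  simpa [this] using hj'

theorem IsKoszulMatrix.empty {K : Type*} [Field K] {n : ℕ} :
    IsKoszulMatrix (ι := Unit) (∅ : Set (Fin n)) (0 : Matrix _ _ (MvPolynomial (Fin n) K))
      (fun _ => 0) () where
  sq := by simp
  homotopy := by simp
  isHomogeneous _ _ := isHomogeneous_zero _ _ _
  wt_eq := by simp
  wt_zero := rfl
  col_zero := by simp
  row_mem := by simp
  exact v _ h := ⟨0, by
    ext a
    simp only [Set.image_empty, Ideal.span_empty, Ideal.mem_bot] at h
    simp [h]⟩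

theorem fromBlocks_smul {R M ι : Type*} [CommRing R] [AddCommGroup M] [Module R M]
    [Fintype ι] [DecidableEq ι] (A B C D : Matrix ι ι R) (v : ι ⊕ ι → M) :
    Matrix.fromBlocks A B C D • v =
      Sum.elim (A • (v ∘ Sum.inl) + B • (v ∘ Sum.inr)) (C • (v ∘ Sum.inl) + D • (v ∘ Sum.inr)) := by
  ext (a | a) <;> simp

theorem IsKoszulMatrix.cone {K : Type*} [Field K] {n : ℕ} {ι : Type*} [Fintype ι] [DecidableEq ι]
    {s : Set (Fin n)} {A : Matrix ι ι (MvPolynomial (Fin n) K)} {wt : ι → ℕ} {o : ι}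
    (hA : IsKoszulMatrix s A wt o) {i : Fin n} (hi : i ∉ s) :
    IsKoszulMatrix (insert i s) (Matrix.fromBlocks A (Matrix.scalar ι (X i)) 0 (-A))
      (Sum.elim wt fun a => wt a + 1) (Sum.inl o) where
  sq := by
    rw [Matrix.fromBlocks_multiply]
    rw [hA.sq, mul_neg, (Matrix.scalar_commute (X i) (Commute.all _) A).eq]
    simp [hA.sq]
  homotopy := by
    intro j hj
    by_cases hji : j = i
    · subst hji
      refine ⟨Matrix.fromBlocks 0 0 1 0, ?_⟩
      rw [Matrix.fromBlocks_multiply, Matrix.fromBlocks_multiply, Matrix.fromBlocks_add]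
      ext (a | a) (b | b) <;> simp [Matrix.diagonal_apply]
    · obtain ⟨H, hH⟩ := hA.homotopy j (hj.resolve_left hji)
      refine ⟨Matrix.fromBlocks H 0 0 (-H), ?_⟩
      rw [Matrix.fromBlocks_multiply, Matrix.fromBlocks_multiply, Matrix.fromBlocks_add]
      have hc := (Matrix.scalar_commute (X i : MvPolynomial (Fin n) K) (Commute.all _) H).eq
      have h1 : A * H + Matrix.scalar ι (X i) * 0 + (H * A + 0 * 0) = Matrix.scalar ι (X j) := by
        simpa using hH
      have h2 : A * 0 + Matrix.scalar ι (X i) * -H + (H * Matrix.scalar ι (X i) + 0 * -A) = 0 := by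
        rw [mul_neg, hc]
        simp
      have h3 : (0 : Matrix ι ι (MvPolynomial (Fin n) K)) * H + -A * 0 + (0 * A + -H * 0) = 0 := by
        simp
      have h4 : 0 * 0 + -A * -H + (0 * Matrix.scalar ι (X i) + -H * -A) =
          Matrix.scalar ι (X j) := by
        simpa using hH
      rw [h1, h2, h3, h4]
      ext (a | a) (b | b) <;> simp [Matrix.diagonal_apply]
  isHomogeneous := by
    rintro (a | a) (b | b)
    · exact hA.isHomogeneous a b
    · by_cases h : a = b
      · simp [h, isHomogeneous_X]
      · simp [h, isHomogeneous_zero]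
    · exact isHomogeneous_zero _ _ _
    · exact (hA.isHomogeneous a b).neg
  wt_eq := by
    rintro (a | a) (b | b) h
    · exact hA.wt_eq a b h
    · by_cases hab : a = b
      · simp [hab]
      · simp [hab] at h
    · simp at h
    · have := hA.wt_eq a b (by simpa using h)
      simp [this]
  wt_zero := hA.wt_zero
  col_zero := by
    rintro (a | a)
    · exact hA.col_zero a
    · rfl
  row_mem := by
    rintro (b | b)
    · exact Ideal.span_mono (Set.image_mono (Set.subset_insert i s)) (hA.row_mem b)
    · by_cases h : o = b
      · subst h
        simpa using Ideal.subset_span (Set.mem_image_of_mem _ (Set.mem_insert i s))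
      · simp [h]
  exact := by
    intro v hv hvo
    rw [fromBlocks_smul] at hv
    have hmem : ∀ w : ι → MvPolynomial (Fin n) K,
        (A • w) o ∈ Ideal.span (X '' s : Set (MvPolynomial (Fin n) K)) := fun w =>
      Ideal.sum_mem _ fun b _ => Ideal.mul_mem_right _ _ (hA.row_mem b)
    have h1 : A • (v ∘ Sum.inl) + (X i : MvPolynomial (Fin n) K) • (v ∘ Sum.inr) = 0 := by
      rw [← Matrix.Module.scalar_smul]
      ext a : 1
      exact congrFun hv (Sum.inl a)
    have h2 : A • (v ∘ Sum.inr) = 0 := by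
      ext a : 1
      have := congrFun hv (Sum.inr a)
      simpa [Finset.sum_neg_distrib] using this
    obtain ⟨c, hc⟩ := hA.exact (v ∘ Sum.inr) h2 (by
      apply mem_span_X_of_X_mul_mem hi
      have := congrFun h1 o
      rw [Pi.add_apply, Pi.smul_apply, smul_eq_mul, Pi.zero_apply] at this
      rw [eq_neg_of_add_eq_zero_right this]
      exact neg_mem (hmem _))
    rw [Set.image_insert_eq, Ideal.mem_span_insert] at hvo
    obtain ⟨g, u, hu, hgu⟩ := hvo
    have hcol : ∀ f : MvPolynomial (Fin n) K, A • (Pi.single o f : ι → _) = 0 := by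
      intro f
      ext a : 1
      rw [Matrix.Module.smul_apply, Finset.sum_eq_single o] <;> simp +contextual [hA.col_zero]
    let c' : ι → MvPolynomial (Fin n) K := c - Pi.single o (c o + g)
    have hc' : A • c' = v ∘ Sum.inr := by
      rw [smul_sub, hcol, hc, sub_zero]
    obtain ⟨e, he⟩ := hA.exact (v ∘ Sum.inl + (X i : MvPolynomial (Fin n) K) • c')
      (by rw [smul_add, matrix_smul_comm, hc', h1])
      (by
        have : c' o = -g := by simp [c']
        rw [Pi.add_apply, Pi.smul_apply, this, Function.comp_apply, hgu]
        convert hu using 1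
        rw [smul_eq_mul]
        ring)
    refine ⟨Sum.elim e (-c'), ?_⟩
    rw [fromBlocks_smul, Sum.elim_comp_inl, Sum.elim_comp_inr, Matrix.Module.scalar_smul, he]
    ext (a | a) : 1
    · simp
    · have := congrFun hc' a
      simpa [-smul_neg, neg_smul_neg] using this

theorem exists_isKoszulMatrix (K : Type*) [Field K] (n : ℕ) :
    ∃ (ι : Type) (_ : Fintype ι) (_ : DecidableEq ι) (A : Matrix ι ι (MvPolynomial (Fin n) K))
      (wt : ι → ℕ) (o : ι), IsKoszulMatrix Set.univ A wt o := by
  suffices ∀ s : Finset (Fin n), ∃ (ι : Type) (_ : Fintype ι) (_ : DecidableEq ι)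
      (A : Matrix ι ι (MvPolynomial (Fin n) K)) (wt : ι → ℕ) (o : ι),
      IsKoszulMatrix (s : Set (Fin n)) A wt o by
    simpa using this Finset.univ
  intro s
  induction s using Finset.induction_on with
  | empty => exact ⟨Unit, _, _, _, _, _, by simpa using IsKoszulMatrix.empty⟩
  | insert i s hi ih =>
    obtain ⟨ι, _, _, A, wt, o, h⟩ := ih
    exact ⟨ι ⊕ ι, inferInstance, inferInstance, _, _, _, by
      simpa using h.cone (i := i) (by simpa using hi)⟩

/-- The homogeneous component of degree `d` in the `ℤ`-grading of the polynomial ring. -/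
noncomputable def intHomogeneousComponent {K : Type*} [Field K] {n : ℕ} (d : ℤ) :
    MvPolynomial (Fin n) K →ₗ[K] MvPolynomial (Fin n) K :=
  if 0 ≤ d then homogeneousComponent d.toNat else 0

theorem intHomogeneousComponent_natCast {K : Type*} [Field K] {n : ℕ} (d : ℕ)
    (f : MvPolynomial (Fin n) K) :
    intHomogeneousComponent (d : ℤ) f = homogeneousComponent d f := by
  simp [intHomogeneousComponent]

theorem intHomogeneousComponent_of_neg {K : Type*} [Field K] {n : ℕ} {d : ℤ} (hd : d < 0)
    (f : MvPolynomial (Fin n) K) : intHomogeneousComponent d f = 0 := by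
  simp [intHomogeneousComponent, not_le.mpr hd]

theorem intHomogeneousComponent_idem {K : Type*} [Field K] {n : ℕ} (d : ℤ)
    (f : MvPolynomial (Fin n) K) :
    intHomogeneousComponent d (intHomogeneousComponent d f) = intHomogeneousComponent d f := by
  rcases lt_or_ge d 0 with hd | hd
  · simp [intHomogeneousComponent_of_neg hd]
  · lift d to ℕ using hd
    simp only [intHomogeneousComponent_natCast]
    exact homogeneousComponent_eq_self (homogeneousComponent_mem d f)

theorem intHomogeneousComponent_eq_zero {K : Type*} [Field K] {n : ℕ} {d : ℤ}
    {f : MvPolynomial (Fin n) K} (h : (f.totalDegree : ℤ) < d) :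
    intHomogeneousComponent d f = 0 := by
  lift d to ℕ using by omega
  rw [intHomogeneousComponent_natCast]
  exact homogeneousComponent_eq_zero _ _ (by exact_mod_cast h)

theorem homogeneousComponent_succ_mul {K : Type*} [Field K] {n : ℕ} (d : ℕ)
    {a : MvPolynomial (Fin n) K} (ha : a.IsHomogeneous 1) (f : MvPolynomial (Fin n) K) :
    homogeneousComponent (d + 1) (a * f) = a * homogeneousComponent d f := by
  conv_lhs => rw [← sum_homogeneousComponent f, Finset.mul_sum, map_sum]
  have h (i : ℕ) : homogeneousComponent (d + 1) (a * homogeneousComponent i f) =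
      if i = d then a * homogeneousComponent d f else 0 := by
    rw [homogeneousComponent_of_mem (ha.mul (homogeneousComponent_isHomogeneous i f))]
    by_cases hi : i = d
    · simp [hi, add_comm]
    · rw [if_neg hi, if_neg (by omega)]
  simp only [h, Finset.sum_ite_eq', Finset.mem_range]
  split_ifs with hd
  · rfl
  · rw [homogeneousComponent_eq_zero _ _ (by omega), mul_zero]

theorem homogeneousComponent_zero_mul {K : Type*} [Field K] {n : ℕ}
    {a : MvPolynomial (Fin n) K} (ha : a.IsHomogeneous 1) (f : MvPolynomial (Fin n) K) :
    homogeneousComponent 0 (a * f) = 0 := by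
  have : coeff 0 a = 0 := ha.coeff_eq_zero (by simp)
  rw [homogeneousComponent_zero, ← constantCoeff_eq, map_mul, constantCoeff_eq, this]
  simp

theorem intHomogeneousComponent_mul {K : Type*} [Field K] {n : ℕ} (d : ℤ)
    {a : MvPolynomial (Fin n) K} (ha : a.IsHomogeneous 1) (f : MvPolynomial (Fin n) K) :
    intHomogeneousComponent d (a * f) = a * intHomogeneousComponent (d - 1) f := by
  rcases lt_or_ge d 0 with hd | hd
  · rw [intHomogeneousComponent_of_neg hd, intHomogeneousComponent_of_neg (by omega), mul_zero]
  · lift d to ℕ using hd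
    cases d with
    | zero =>
      rw [intHomogeneousComponent_natCast, homogeneousComponent_zero_mul ha,
        intHomogeneousComponent_of_neg (by simp), mul_zero]
    | succ d =>
      rw [intHomogeneousComponent_natCast, homogeneousComponent_succ_mul d ha,
        ← intHomogeneousComponent_natCast]
      simp

theorem IsKoszulMatrix.intHomogeneousComponent_smul {K : Type*} [Field K] {n : ℕ} {ι : Type*}
    [Fintype ι] [DecidableEq ι] {s : Set (Fin n)} {A : Matrix ι ι (MvPolynomial (Fin n) K)}
    {wt : ι → ℕ} {o : ι} (hA : IsKoszulMatrix s A wt o) (t : ℤ) (v : ι → MvPolynomial (Fin n) K)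
    (a : ι) :
    intHomogeneousComponent (t - wt a) ((A • v) a) =
      (A • fun b => intHomogeneousComponent (t - wt b) (v b)) a := by
  simp only [Matrix.Module.smul_apply, map_sum, smul_eq_mul]
  refine Finset.sum_congr rfl fun b _ => ?_
  rw [intHomogeneousComponent_mul _ (hA.isHomogeneous a b)]
  by_cases h : A a b = 0
  · simp [h]
  · rw [hA.wt_eq a b h]
    push_cast
    rw [sub_sub]

/-- Every Koszul cycle with coefficients in `N` which is homogeneous of internal degree `t`
is a boundary, where `hom d` is the predicate of being homogeneous of degree `d`. -/
def KoszulVanishing {K : Type*} [Field K] {n : ℕ} {ι : Type*} [Fintype ι] [DecidableEq ι]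
    (A : Matrix ι ι (MvPolynomial (Fin n) K)) (wt : ι → ℕ) {M : Type*} [AddCommGroup M]
    [Module (MvPolynomial (Fin n) K) M] (hom : ℤ → M → Prop)
    (N : Submodule (MvPolynomial (Fin n) K) M) (t : ℤ) : Prop :=
  ∀ z : ι → M, (∀ a, z a ∈ N) → (∀ a, hom (t - wt a) (z a)) → A • z = 0 →
    ∃ w : ι → M, (∀ a, w a ∈ N) ∧ A • w = z

theorem apply_mem_of_mem_smul_top {R ι : Type*} [CommRing R] (J : Ideal R) {f : ι → R}
    (hf : f ∈ J • (⊤ : Submodule R (ι → R))) (r : ι) : f r ∈ J := by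
  induction hf using Submodule.smul_induction_on' with
  | smul x hx y _ => exact J.mul_mem_right _ hx
  | add x _ y _ hx hy => exact J.add_mem hx hy

/-- Homogeneity of degree `d` in the graded free module `⊕_r R(-deg r)`. -/
def IsFreeHomogeneous {K : Type*} [Field K] {n s : ℕ} (deg : Fin s → ℕ) (d : ℤ)
    (f : Fin s → MvPolynomial (Fin n) K) : Prop :=
  ∀ r, intHomogeneousComponent (d - deg r) (f r) = f r

theorem isFreeHomogeneous_natCast_iff {K : Type*} [Field K] {n s : ℕ} (deg : Fin s → ℕ) (d : ℕ)
    (f : Fin s → MvPolynomial (Fin n) K) :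
    IsFreeHomogeneous deg d f ↔ f ∈ freeHomPiece n deg d := by
  simp only [IsFreeHomogeneous, freeHomPiece, Submodule.mem_pi, Set.mem_univ, true_imp_iff]
  refine forall_congr' fun r => ?_
  split_ifs with h
  · rw [← Nat.cast_sub h, intHomogeneousComponent_natCast]
    exact ⟨fun h => h ▸ homogeneousComponent_mem _ _, homogeneousComponent_eq_self⟩
  · rw [intHomogeneousComponent_of_neg (by omega), Submodule.mem_bot, eq_comm]

theorem IsFreeHomogeneous.eq_zero {K : Type*} [Field K] {n s : ℕ} {deg : Fin s → ℕ} {d : ℤ}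
    (hd : d < 0) {f : Fin s → MvPolynomial (Fin n) K} (hf : IsFreeHomogeneous deg d f) : f = 0 := by
  ext1 r
  rw [← hf r, intHomogeneousComponent_of_neg (by omega)]
  rfl

theorem KoszulVanishing.ker {K : Type*} [Field K] {n : ℕ} {ι : Type*} [Fintype ι] [DecidableEq ι]
    {A : Matrix ι ι (MvPolynomial (Fin n) K)} {wt : ι → ℕ} {o : ι}
    (hA : IsKoszulMatrix Set.univ A wt o) {M : Type*} [AddCommGroup M]
    [Module (MvPolynomial (Fin n) K) M] {hom : ℤ → M → Prop} {s : ℕ} {deg : Fin s → ℕ}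
    (φ : (Fin s → MvPolynomial (Fin n) K) →ₗ[MvPolynomial (Fin n) K] M)
    (hφ : ∀ d f, IsFreeHomogeneous deg d f → hom d (φ f))
    (hker : LinearMap.ker φ ≤ polyMaxIdeal K n • ⊤) {t : ℤ}
    (h : KoszulVanishing A wt hom (LinearMap.range φ) t) :
    KoszulVanishing A wt (IsFreeHomogeneous deg) (LinearMap.ker φ) t := by
  intro z hz hhom hcyc
  have hex (r : Fin s) : ∃ w : ι → MvPolynomial (Fin n) K, A • w = fun a => z a r := by
    apply hA.exact
    · ext1 a
      rw [← matrix_smul_pi_apply, hcyc]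
      rfl
    · rw [Set.image_univ]
      exact apply_mem_of_mem_smul_top _ (hker (hz o)) r
  choose w hw using hex
  let w' : ι → Fin s → MvPolynomial (Fin n) K := fun a r =>
    intHomogeneousComponent (t - deg r - wt a) (w r a)
  have hw' : A • w' = z := by
    ext1 a
    ext1 r
    have h1 := hA.intHomogeneousComponent_smul (t - deg r) (w r) a
    rw [hw, sub_right_comm, hhom a r] at h1
    rw [h1, matrix_smul_pi_apply]
  obtain ⟨u, hu, hu'⟩ := h (fun a => φ (w' a)) (fun a => ⟨_, rfl⟩)
    (fun a => hφ _ _ fun r => by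
      simp only [w']
      rw [sub_right_comm, intHomogeneousComponent_idem])
    (by
      rw [← matrix_smul_map, hw']
      ext1 a
      exact hz a)
  choose v hv using hu
  refine ⟨w' - A • v, fun a => ?_, ?_⟩
  · rw [LinearMap.mem_ker, Pi.sub_apply, map_sub, congrFun (matrix_smul_map φ A v) a, funext hv,
      hu', sub_self]
  · rw [smul_sub, hw', ← mul_smul, hA.sq, zero_smul, sub_zero]

theorem not_koszulVanishing_range {K : Type*} [Field K] {n : ℕ} {ι : Type*} [Fintype ι]
    [DecidableEq ι] {A : Matrix ι ι (MvPolynomial (Fin n) K)} {wt : ι → ℕ} {o : ι}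
    (hA : IsKoszulMatrix Set.univ A wt o) {M : Type*} [AddCommGroup M]
    [Module (MvPolynomial (Fin n) K) M] {hom : ℤ → M → Prop} (hom_zero : ∀ d, hom d 0)
    {s : ℕ} {deg : Fin s → ℕ}
    (φ : (Fin s → MvPolynomial (Fin n) K) →ₗ[MvPolynomial (Fin n) K] M)
    (hφ : ∀ d f, IsFreeHomogeneous deg d f → hom d (φ f))
    (hker : LinearMap.ker φ ≤ polyMaxIdeal K n • ⊤) (r : Fin s) :
    ¬ KoszulVanishing A wt hom (LinearMap.range φ) (deg r) := by
  intro h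
  have hhom : IsFreeHomogeneous deg (deg r) (Pi.single r (1 : MvPolynomial (Fin n) K)) := by
    intro q
    by_cases hq : q = r
    · subst hq
      simp [intHomogeneousComponent]
    · simp [Pi.single_eq_of_ne hq]
  obtain ⟨w, hw, hw'⟩ := h (Pi.single o (φ (Pi.single r 1)))
    (fun a => by
      by_cases ha : a = o
      · subst ha
        simp
      · simp [Pi.single_eq_of_ne ha])
    (fun a => by
      by_cases ha : a = o
      · subst ha
        simpa [hA.wt_zero] using hφ _ _ hhom
      · simpa [Pi.single_eq_of_ne ha] using hom_zero _)
    (by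
      ext1 a
      rw [Matrix.Module.smul_apply, Finset.sum_eq_single o] <;> simp +contextual [hA.col_zero])
  choose v hv using hw
  have h1 : φ ((A • v) o) = φ (Pi.single r 1) := by
    have := congrFun hw' o
    rw [Pi.single_eq_same] at this
    rw [← this, congrFun (matrix_smul_map φ A v) o, funext hv]
  have h2 : (Pi.single r 1 : Fin s → MvPolynomial (Fin n) K) - (A • v) o ∈ LinearMap.ker φ := by
    rw [LinearMap.mem_ker, map_sub, h1, sub_self]
  have h3 : (A • v) o r ∈ polyMaxIdeal K n := by
    rw [matrix_smul_pi_apply]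
    refine Ideal.sum_mem _ fun b _ => Ideal.mul_mem_right _ _ ?_
    simpa [polyMaxIdeal] using hA.row_mem b
  have h4 := (polyMaxIdeal K n).add_mem (apply_mem_of_mem_smul_top _ (hker h2) r) h3
  rw [Pi.sub_apply, sub_add_cancel, Pi.single_eq_same, polyMaxIdeal, ← Set.image_univ,
    mem_ideal_span_X_image] at h4
  obtain ⟨i, -, hi⟩ := h4 0 (by simp)
  exact hi rfl

theorem sub_C_constantCoeff_mem {K : Type*} [Field K] {n : ℕ} (f : MvPolynomial (Fin n) K) :
    f - C (constantCoeff f) ∈ polyMaxIdeal K n := by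
  rw [polyMaxIdeal, ← Set.image_univ, mem_ideal_span_X_image]
  intro m hm
  by_contra! h
  obtain rfl : m = 0 := by
    ext i
    exact h i trivial
  simp [constantCoeff_eq] at hm

/-- Modulo `m J`, every element of `J` is represented by an element of degree at most `d`. -/
def GeneratedInDegreeLE {K : Type*} [Field K] {n : ℕ} (J : Ideal (MvPolynomial (Fin n) K))
    (d : ℕ) : Prop :=
  ∀ f ∈ J, ∃ g ∈ J, g.totalDegree ≤ d ∧ f - g ∈ polyMaxIdeal K n * J

theorem generatedInDegreeLE_span {K : Type*} [Field K] {n : ℕ}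
    (G : Finset (MvPolynomial (Fin n) K)) :
    GeneratedInDegreeLE (Ideal.span (G : Set (MvPolynomial (Fin n) K)))
      (G.sup totalDegree) := by
  intro f hf
  induction hf using Submodule.span_induction with
  | mem f hf => exact ⟨f, Ideal.subset_span hf, Finset.le_sup (f := totalDegree) hf, by simp⟩
  | zero => exact ⟨0, zero_mem _, by simp, by simp⟩
  | add f f' _ _ h h' =>
    obtain ⟨g, hg, hd, hm⟩ := h
    obtain ⟨g', hg', hd', hm'⟩ := h'
    refine ⟨g + g', add_mem hg hg', (totalDegree_add _ _).trans (max_le hd hd'), ?_⟩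
    rw [add_sub_add_comm]
    exact add_mem hm hm'
  | smul c f _ h =>
    obtain ⟨g, hg, hd, hm⟩ := h
    refine ⟨C (constantCoeff c) * g, Ideal.mul_mem_left _ _ hg, (totalDegree_mul _ _).trans ?_, ?_⟩
    · rwa [totalDegree_C, zero_add]
    · have : c • f - C (constantCoeff c) * g = c * (f - g) + (c - C (constantCoeff c)) * g := by
        rw [smul_eq_mul]
        ring
      rw [this]
      exact add_mem (Ideal.mul_mem_left _ _ hm) (Ideal.mul_mem_mul (sub_C_constantCoeff_mem c) hg)

theorem GeneratedInDegreeLE.mul {K : Type*} [Field K] {n : ℕ}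
    {J J' : Ideal (MvPolynomial (Fin n) K)} {d d' : ℕ} (h : GeneratedInDegreeLE J d) (h' : GeneratedInDegreeLE J' d') :
    GeneratedInDegreeLE (J * J') (d + d') := by
  intro f hf
  induction hf using Submodule.mul_induction_on' with
  | mem_mul_mem f hf f' hf' =>
    obtain ⟨g, hg, hd, hm⟩ := h f hf
    obtain ⟨g', hg', hd', hm'⟩ := h' f' hf'
    refine ⟨g * g', Ideal.mul_mem_mul hg hg',
      (totalDegree_mul _ _).trans (Nat.add_le_add hd hd'), ?_⟩
    have : f * f' - g * g' = (f - g) * f' + g * (f' - g') := by ring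
    rw [this]
    refine add_mem ?_ ?_
    · rw [← mul_assoc]
      exact Ideal.mul_mem_mul hm hf'
    · rw [mul_left_comm]
      exact Ideal.mul_mem_mul hg hm'
  | add f _ f' _ h h' =>
    obtain ⟨g, hg, hd, hm⟩ := h
    obtain ⟨g', hg', hd', hm'⟩ := h'
    refine ⟨g + g', add_mem hg hg', (totalDegree_add _ _).trans (max_le hd hd'), ?_⟩
    rw [add_sub_add_comm]
    exact add_mem hm hm'

theorem GeneratedInDegreeLE.pow {K : Type*} [Field K] {n : ℕ} {J : Ideal (MvPolynomial (Fin n) K)}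
    {d : ℕ} (h : GeneratedInDegreeLE J d) (k : ℕ) : GeneratedInDegreeLE (J ^ k) (d * k) := by
  induction k with
  | zero =>
    intro f _
    refine ⟨C (constantCoeff f), by simp, by simp, ?_⟩
    simpa using sub_C_constantCoeff_mem f
  | succ k ih => exact ih.mul h

theorem IsKoszulMatrix.exists_smul_eq_of_mem {K : Type*} [Field K] {n : ℕ} {ι : Type*} [Fintype ι]
    [DecidableEq ι] {A : Matrix ι ι (MvPolynomial (Fin n) K)} {wt : ι → ℕ} {o : ι}
    (hA : IsKoszulMatrix Set.univ A wt o) {f : MvPolynomial (Fin n) K} (hf : f ∈ polyMaxIdeal K n)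
    {J : Ideal (MvPolynomial (Fin n) K)} {v : ι → MvPolynomial (Fin n) K} (hv : ∀ a, v a ∈ J)
    (hcyc : A • v = 0) : ∃ w : ι → MvPolynomial (Fin n) K, (∀ a, w a ∈ J) ∧ A • w = f • v := by
  rw [polyMaxIdeal] at hf
  induction hf using Submodule.span_induction with
  | mem f hf =>
    obtain ⟨i, rfl⟩ := hf
    obtain ⟨H, hH⟩ := hA.homotopy i trivial
    refine ⟨H • v, matrix_smul_mem J H hv, ?_⟩
    rw [← Matrix.Module.scalar_smul, ← hH, add_smul, mul_smul, mul_smul, hcyc, smul_zero, add_zero]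
  | zero => exact ⟨0, fun a => zero_mem _, by simp⟩
  | add f f' _ _ h h' =>
    obtain ⟨w, hw, hw'⟩ := h
    obtain ⟨u, hu, hu'⟩ := h'
    exact ⟨w + u, fun a => add_mem (hw a) (hu a), by rw [smul_add, hw', hu', add_smul]⟩
  | smul c f _ h =>
    obtain ⟨w, hw, hw'⟩ := h
    exact ⟨c • w, fun a => Ideal.mul_mem_left _ _ (hw a), by
      rw [matrix_smul_comm, hw', smul_assoc]⟩

theorem IsKoszulMatrix.exists_smul_eq_of_mem_mul {K : Type*} [Field K] {n : ℕ} {ι : Type*}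
    [Fintype ι] [DecidableEq ι] {A : Matrix ι ι (MvPolynomial (Fin n) K)} {wt : ι → ℕ} {o : ι}
    (hA : IsKoszulMatrix Set.univ A wt o) {J J' : Ideal (MvPolynomial (Fin n) K)}
    {f : MvPolynomial (Fin n) K} (hf : f ∈ polyMaxIdeal K n * J)
    {v : ι → MvPolynomial (Fin n) K} (hv : ∀ a, v a ∈ J') (hcyc : A • v = 0) :
    ∃ w : ι → MvPolynomial (Fin n) K, (∀ a, w a ∈ J * J') ∧ A • w = f • v := by
  induction hf using Submodule.mul_induction_on' with
  | mem_mul_mem f hf g hg =>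
    obtain ⟨w, hw, hw'⟩ := hA.exists_smul_eq_of_mem hf (v := g • v) (J := J * J')
      (fun a => Ideal.mul_mem_mul hg (hv a)) (by rw [matrix_smul_comm, hcyc, smul_zero])
    exact ⟨w, hw, by rw [hw', mul_smul]⟩
  | add f _ f' _ h h' =>
    obtain ⟨w, hw, hw'⟩ := h
    obtain ⟨u, hu, hu'⟩ := h'
    exact ⟨w + u, fun a => add_mem (hw a) (hu a), by rw [smul_add, hw', hu', add_smul]⟩

/-- `v` is congruent, modulo boundaries with coefficients in `J`, to a family of polynomials of
degree at most `d`. -/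
def HasLowDegreeRepresentative {K : Type*} [Field K] {n : ℕ} {ι : Type*} [Fintype ι]
    [DecidableEq ι] (A : Matrix ι ι (MvPolynomial (Fin n) K)) (J : Ideal (MvPolynomial (Fin n) K))
    (d : ℕ) (v : ι → MvPolynomial (Fin n) K) : Prop :=
  ∃ w : ι → MvPolynomial (Fin n) K, (∀ a, w a ∈ J) ∧ ∀ a, (v a - (A • w) a).totalDegree ≤ d

theorem HasLowDegreeRepresentative.add {K : Type*} [Field K] {n : ℕ} {ι : Type*} [Fintype ι]
    [DecidableEq ι] {A : Matrix ι ι (MvPolynomial (Fin n) K)} {J : Ideal (MvPolynomial (Fin n) K)}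
    {d : ℕ} {v v' : ι → MvPolynomial (Fin n) K} (h : HasLowDegreeRepresentative A J d v)
    (h' : HasLowDegreeRepresentative A J d v') : HasLowDegreeRepresentative A J d (v + v') := by
  obtain ⟨w, hw, hd⟩ := h
  obtain ⟨w', hw', hd'⟩ := h'
  refine ⟨w + w', fun a => add_mem (hw a) (hw' a), fun a => ?_⟩
  rw [smul_add, Pi.add_apply, Pi.add_apply, add_sub_add_comm]
  exact (totalDegree_add _ _).trans (max_le (hd a) (hd' a))

theorem HasLowDegreeRepresentative.sum {K : Type*} [Field K] {n : ℕ} {ι : Type*} [Fintype ι]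
    [DecidableEq ι] {A : Matrix ι ι (MvPolynomial (Fin n) K)} {J : Ideal (MvPolynomial (Fin n) K)}
    {d : ℕ} {κ : Type*} (S : Finset κ) {v : κ → ι → MvPolynomial (Fin n) K}
    (h : ∀ i ∈ S, HasLowDegreeRepresentative A J d (v i)) :
    HasLowDegreeRepresentative A J d (∑ i ∈ S, v i) :=
  Finset.sum_induction _ _ (fun _ _ => HasLowDegreeRepresentative.add)
    ⟨0, fun _ => zero_mem _, by simp⟩ h

/-- The Koszul cycles with coefficients in the Rees algebra. -/
noncomputable def reesCycles {K : Type*} [Field K] {n : ℕ} {ι : Type*} [Fintype ι] [DecidableEq ι]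
    (A : Matrix ι ι (MvPolynomial (Fin n) K)) (I : Ideal (MvPolynomial (Fin n) K)) :
    Submodule (reesAlgebra I) (ι → reesAlgebra I) where
  carrier := {v | A • v = 0}
  add_mem' {v w} hv hw := by
    rw [Set.mem_ofPred_eq] at *
    rw [smul_add, hv, hw, add_zero]
  zero_mem' := smul_zero A
  smul_mem' c v hv := by
    rw [Set.mem_ofPred_eq] at *
    rw [matrix_smul_comm, hv, smul_zero]

theorem exists_totalDegree_coeff_le {K : Type*} [Field K] {n : ℕ}
    (p : Polynomial (MvPolynomial (Fin n) K)) : ∃ B, ∀ k, (p.coeff k).totalDegree ≤ B := by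
  refine ⟨p.support.sup fun k => (p.coeff k).totalDegree, fun k => ?_⟩
  by_cases hk : k ∈ p.support
  · exact Finset.le_sup (f := fun k => (p.coeff k).totalDegree) hk
  · simp [Polynomial.notMem_support_iff.mp hk]

/-- The coefficient of `T ^ k` in a vector over the Rees algebra. -/
noncomputable def reesCoeff {K : Type*} [Field K] {n : ℕ} {ι : Type*}
    {I : Ideal (MvPolynomial (Fin n) K)} (k : ℕ) (v : ι → reesAlgebra I) (a : ι) :
    MvPolynomial (Fin n) K :=
  (v a : Polynomial (MvPolynomial (Fin n) K)).coeff k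

theorem matrix_smul_reesCoeff {K : Type*} [Field K] {n : ℕ} {ι : Type*} [Fintype ι]
    [DecidableEq ι] (A : Matrix ι ι (MvPolynomial (Fin n) K)) {I : Ideal (MvPolynomial (Fin n) K)}
    (k : ℕ) (v : ι → reesAlgebra I) : A • reesCoeff k v = reesCoeff k (A • v) := by
  ext1 a
  simp [reesCoeff]

theorem reesCoeff_smul {K : Type*} [Field K] {n : ℕ} {ι : Type*}
    {I : Ideal (MvPolynomial (Fin n) K)} (k : ℕ) (c : reesAlgebra I) (v : ι → reesAlgebra I) :
    reesCoeff k (c • v) = ∑ x ∈ Finset.HasAntidiagonal.antidiagonal k,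
      (c : Polynomial (MvPolynomial (Fin n) K)).coeff x.1 • reesCoeff x.2 v := by
  ext1 a
  simp [reesCoeff, Polynomial.coeff_mul]

theorem reesCoeff_sum {K : Type*} [Field K] {n : ℕ} {ι κ : Type*}
    {I : Ideal (MvPolynomial (Fin n) K)} (k : ℕ) (S : Finset κ) (v : κ → ι → reesAlgebra I) :
    reesCoeff k (∑ i ∈ S, v i) = ∑ i ∈ S, reesCoeff k (v i) := by
  ext1 a
  simp [reesCoeff]

theorem IsKoszulMatrix.exists_hasLowDegreeRepresentative {K : Type*} [Field K] {n : ℕ} {ι : Type*}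
    [Fintype ι] [DecidableEq ι] {A : Matrix ι ι (MvPolynomial (Fin n) K)} {wt : ι → ℕ} {o : ι}
    (hA : IsKoszulMatrix Set.univ A wt o) {I : Ideal (MvPolynomial (Fin n) K)} {d : ℕ}
    (hI : GeneratedInDegreeLE I d) :
    ∃ B : ℕ, ∀ (k : ℕ) (v : ι → MvPolynomial (Fin n) K), (∀ a, v a ∈ I ^ k) → A • v = 0 →
      HasLowDegreeRepresentative A (I ^ k) (d * k + B) v := by
  obtain ⟨G, hG⟩ := IsNoetherian.noetherian (reesCycles A I)
  have hB (g : ι → reesAlgebra I) (a : ι) :=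
    exists_totalDegree_coeff_le (g a : Polynomial (MvPolynomial (Fin n) K))
  choose B hB using hB
  refine ⟨G.sup fun g => Finset.univ.sup (B g), fun k v hv hcyc => ?_⟩
  let z : ι → reesAlgebra I := fun a =>
    ⟨Polynomial.monomial k (v a), reesAlgebra.monomial_mem.mpr (hv a)⟩
  have hzv : reesCoeff k z = v := by
    ext1 a
    simp [reesCoeff, z]
  have hz : z ∈ reesCycles A I := by
    change A • z = 0
    ext1 a
    apply Subtype.ext
    refine Polynomial.ext fun q => ?_
    have h1 : reesCoeff q (A • z) = 0 := by
      rw [← matrix_smul_reesCoeff]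
      by_cases hq : k = q
      · rw [← hq, hzv, hcyc]
      · have : reesCoeff q z = 0 := by
          ext1 a
          simp [reesCoeff, z, Polynomial.coeff_monomial, hq]
        rw [this, smul_zero]
    exact congrFun h1 a
  rw [← hG] at hz
  obtain ⟨c, -, hc⟩ := Submodule.mem_span_finset.mp hz
  rw [← hzv, ← hc, reesCoeff_sum]
  refine HasLowDegreeRepresentative.sum _ fun g hg => ?_
  rw [reesCoeff_smul]
  refine HasLowDegreeRepresentative.sum _ fun x hx => ?_
  rw [Finset.HasAntidiagonal.mem_antidiagonal] at hx
  obtain ⟨f, hf, hd, hm⟩ := hI.pow x.1 _ ((c g).2 x.1)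
  have hgZ : A • g = 0 := by
    have : g ∈ reesCycles A I := hG ▸ Submodule.subset_span hg
    exact this
  obtain ⟨w, hw, hw'⟩ := hA.exists_smul_eq_of_mem_mul hm (v := reesCoeff x.2 g) (J' := I ^ x.2)
    (fun a => (g a).2 x.2) (by
      rw [matrix_smul_reesCoeff, hgZ]
      rfl)
  refine ⟨w, fun a => ?_, fun a => ?_⟩
  · rw [← hx, pow_add]
    exact hw a
  · rw [hw', ← Pi.sub_apply, ← sub_smul, sub_sub_cancel]
    refine (totalDegree_mul _ _).trans (Nat.add_le_add (hd.trans ?_) ((hB g a x.2).trans ?_))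
    · exact Nat.mul_le_mul_left d (by omega)
    · exact (Finset.le_sup (f := B g) (Finset.mem_univ a)).trans
        (Finset.le_sup (f := fun g => Finset.univ.sup (B g)) hg)

section

attribute [local instance] MvPolynomial.gradedAlgebra

theorem homogeneousComponent_mem_pow {K : Type*} [Field K] {n : ℕ}
    {I : Ideal (MvPolynomial (Fin n) K)}
    (hI : ∀ f ∈ I, ∀ p : ℕ, homogeneousComponent p f ∈ I) (k : ℕ) {f : MvPolynomial (Fin n) K}
    (hf : f ∈ I ^ k) (p : ℕ) : homogeneousComponent p f ∈ I ^ k := by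
  have h : I.IsHomogeneous (homogeneousSubmodule (Fin n) K) := by
    intro p f hf
    exact (decomposition.decompose'_apply f p).symm ▸ hI f hf p
  have hk : (I ^ k).IsHomogeneous (homogeneousSubmodule (Fin n) K) := by
    clear hf
    induction k with
    | zero => simpa using Ideal.IsHomogeneous.top _
    | succ k ih =>
      rw [pow_succ]
      exact ih.mul h
  exact homogeneousComponent_mem_of_mem hk hf p

end

theorem intHomogeneousComponent_mem_pow {K : Type*} [Field K] {n : ℕ}
    {I : Ideal (MvPolynomial (Fin n) K)}
    (hI : ∀ f ∈ I, ∀ p : ℕ, homogeneousComponent p f ∈ I) (k : ℕ) {f : MvPolynomial (Fin n) K}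
    (hf : f ∈ I ^ k) (d : ℤ) : intHomogeneousComponent d f ∈ I ^ k := by
  rcases lt_or_ge d 0 with hd | hd
  · simp [intHomogeneousComponent_of_neg hd]
  · lift d to ℕ using hd
    rw [intHomogeneousComponent_natCast]
    exact homogeneousComponent_mem_pow hI k hf d

theorem IsKoszulMatrix.koszulVanishing_pow {K : Type*} [Field K] {n : ℕ} {ι : Type*}
    [Fintype ι] [DecidableEq ι] {A : Matrix ι ι (MvPolynomial (Fin n) K)} {wt : ι → ℕ} {o : ι}
    (hA : IsKoszulMatrix Set.univ A wt o) {I : Ideal (MvPolynomial (Fin n) K)}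
    (hI : ∀ f ∈ I, ∀ p : ℕ, homogeneousComponent p f ∈ I) {k D : ℕ}
    (hD : ∀ v : ι → MvPolynomial (Fin n) K, (∀ a, v a ∈ I ^ k) → A • v = 0 →
      HasLowDegreeRepresentative A (I ^ k) D v) {t : ℤ} (ht : ∀ a, D + wt a < t) :
    KoszulVanishing A wt (fun d (f : ↥(I ^ k)) => intHomogeneousComponent d f.1 = f.1) ⊤ t := by
  intro z _ hz hcyc
  have hval (v : ι → ↥(I ^ k)) (a : ι) :
      ((A • v) a : MvPolynomial (Fin n) K) = (A • fun b => (v b : MvPolynomial (Fin n) K)) a := by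
    simp
  obtain ⟨w, hw, hd⟩ := hD (fun a => z a) (fun a => (z a).2) (by
    ext1 a
    rw [← hval, hcyc]
    rfl)
  refine ⟨fun a => ⟨_, intHomogeneousComponent_mem_pow hI k (hw a) (t - wt a)⟩,
    fun _ => trivial, ?_⟩
  ext1 a
  apply Subtype.ext
  refine (hval _ a).trans ?_
  have h1 := intHomogeneousComponent_eq_zero (d := t - wt a) (f := (z a).1 - (A • w) a) (by
    have := ht a
    have : ((z a).1 - (A • w) a).totalDegree ≤ D := hd a
    omega)
  rw [map_sub, hz a, sub_eq_zero, hA.intHomogeneousComponent_smul] at h1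
  exact h1.symm

theorem GradedMinFreeRes.aug_hom {K : Type*} [Field K] {n : ℕ} {M : Type*} [AddCommGroup M]
    [Module (MvPolynomial (Fin n) K) M] [Module K M] {ℳ : ℕ → Submodule K M}
    (F : GradedMinFreeRes n M ℳ) {hom : ℤ → M → Prop} (hom_zero : ∀ d, hom d 0)
    (hom_of_mem : ∀ (d : ℕ) (f : M), f ∈ ℳ d → hom d f) (d : ℤ)
    (f : Fin (F.β 0) → MvPolynomial (Fin n) K) (hf : IsFreeHomogeneous (F.deg 0) d f) :
    hom d (F.aug f) := by
  rcases lt_or_ge d 0 with hd | hd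
  · rw [hf.eq_zero hd, map_zero]
    exact hom_zero d
  · lift d to ℕ using hd
    exact hom_of_mem d _ (F.aug_graded d f ((isFreeHomogeneous_natCast_iff _ _ _).mp hf))

theorem GradedMinFreeRes.d_hom {K : Type*} [Field K] {n : ℕ} {M : Type*} [AddCommGroup M]
    [Module (MvPolynomial (Fin n) K) M] [Module K M] {ℳ : ℕ → Submodule K M}
    (F : GradedMinFreeRes n M ℳ) (j : ℕ) (d : ℤ)
    (f : Fin (F.β (j + 1)) → MvPolynomial (Fin n) K)
    (hf : IsFreeHomogeneous (F.deg (j + 1)) d f) :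
    IsFreeHomogeneous (F.deg j) d (F.d j f) := by
  rcases lt_or_ge d 0 with hd | hd
  · rw [hf.eq_zero hd, map_zero]
    exact fun r => map_zero _
  · lift d to ℕ using hd
    rw [isFreeHomogeneous_natCast_iff] at hf ⊢
    exact F.d_graded j d f hf

theorem GradedMinFreeRes.koszulVanishing {K : Type*} [Field K] {n : ℕ} {ι : Type*} [Fintype ι]
    [DecidableEq ι] {A : Matrix ι ι (MvPolynomial (Fin n) K)} {wt : ι → ℕ} {o : ι}
    (hA : IsKoszulMatrix Set.univ A wt o) {M : Type*} [AddCommGroup M]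
    [Module (MvPolynomial (Fin n) K) M] [Module K M] {ℳ : ℕ → Submodule K M}
    (F : GradedMinFreeRes n M ℳ) {hom : ℤ → M → Prop} (hom_zero : ∀ d, hom d 0)
    (hom_of_mem : ∀ (d : ℕ) (f : M), f ∈ ℳ d → hom d f) {t : ℤ}
    (h : KoszulVanishing A wt hom (⊤ : Submodule (MvPolynomial (Fin n) K) M) t) (j : ℕ) :
    KoszulVanishing A wt (IsFreeHomogeneous (F.deg j)) (LinearMap.range (F.d j)) t := by
  induction j with
  | zero =>
    rw [← LinearMap.range_eq_top.mpr F.aug_surj] at h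
    rw [← F.exact_aug]
    exact h.ker hA F.aug (F.aug_hom hom_zero hom_of_mem) (F.exact_aug ▸ F.minimal 0)
  | succ j ih =>
    rw [← F.exact j]
    exact ih.ker hA (F.d j) (F.d_hom j) (F.exact j ▸ F.minimal (j + 1))

theorem GradedMinFreeRes.not_koszulVanishing {K : Type*} [Field K] {n : ℕ} {ι : Type*} [Fintype ι]
    [DecidableEq ι] {A : Matrix ι ι (MvPolynomial (Fin n) K)} {wt : ι → ℕ} {o : ι}
    (hA : IsKoszulMatrix Set.univ A wt o) {M : Type*} [AddCommGroup M]
    [Module (MvPolynomial (Fin n) K) M] [Module K M] {ℳ : ℕ → Submodule K M}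
    (F : GradedMinFreeRes n M ℳ) {hom : ℤ → M → Prop} (hom_zero : ∀ d, hom d 0)
    (hom_of_mem : ∀ (d : ℕ) (f : M), f ∈ ℳ d → hom d f) (j : ℕ) (r : Fin (F.β j)) :
    ¬ KoszulVanishing A wt hom (⊤ : Submodule (MvPolynomial (Fin n) K) M) (F.deg j r) := by
  intro h
  cases j with
  | zero =>
    rw [← LinearMap.range_eq_top.mpr F.aug_surj] at h
    exact not_koszulVanishing_range hA hom_zero F.aug (F.aug_hom hom_zero hom_of_mem)
      (F.exact_aug ▸ F.minimal 0) r h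
  | succ j =>
    exact not_koszulVanishing_range hA (fun _ _ => map_zero _) (F.d j) (F.d_hom j)
      (F.exact j ▸ F.minimal (j + 1)) r (F.koszulVanishing hA hom_zero hom_of_mem h j)

/-- Let `I ⊆ K[x_1, …, x_n]` be a graded ideal.  Then there are integers
`a` and `b` such that `reg(I^k) ≤ a k + b` for all `k ≥ 1`:  for every minimal graded free
resolution of `I^k` (with the grading of `I^k` induced from `K[x_1, …, x_n]`), each twist
`deg j r` satisfies `deg j r - j ≤ a k + b`. -/
theorem statement11 {K : Type*} [Field K] {n : ℕ} (I : Ideal (MvPolynomial (Fin n) K))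
    (hIhom : ∀ f ∈ I, ∀ p : ℕ, MvPolynomial.homogeneousComponent p f ∈ I) :
    ∃ a b : ℤ, ∀ k : ℕ, 1 ≤ k →
      ∀ F : GradedMinFreeRes n ↥(I ^ k)
        (fun t => Submodule.comap ((I ^ k).subtype.restrictScalars K)
          (homogeneousSubmodule (Fin n) K t)),
        ∀ (j : ℕ) (r : Fin (F.β j)),
          (F.deg j r : ℤ) - (j : ℤ) ≤ a * (k : ℤ) + b := by
  obtain ⟨ι, _, _, A, wt, o, hA⟩ := exists_isKoszulMatrix K n
  obtain ⟨G, hG⟩ := IsNoetherian.noetherian I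
  have hd : GeneratedInDegreeLE I (G.sup totalDegree) := hG ▸ generatedInDegreeLE_span G
  obtain ⟨B, hB⟩ := hA.exists_hasLowDegreeRepresentative hd
  refine ⟨(G.sup totalDegree : ℕ), (B + Finset.univ.sup wt : ℕ), fun k _ F j r => ?_⟩
  by_contra! hlt
  refine F.not_koszulVanishing hA (hom := fun d f => intHomogeneousComponent d f.1 = f.1)
    (fun _ => map_zero _) (fun d f hf => ?_) j r
    (hA.koszulVanishing_pow hIhom (hB k) fun a => ?_)
  · rw [intHomogeneousComponent_natCast]
    exact homogeneousComponent_eq_self hf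
  · have : wt a ≤ Finset.univ.sup wt := Finset.le_sup (Finset.mem_univ a)
    push_cast at hlt ⊢
    omega
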